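/- Let ℓ ∈ ℕ be even and let Q be a quasi-interpolation operator induced by an even sequence Λ = (λ(j))_{|j|≤μ}, μ ≥ ℓ/2 - 1. For a continuous 1-periodic function f on ℝ and k ≥ 1, write q_k(f) := Q_k(f) - Q_{k-1}(f) = Σ_{s∈I(k)} c_{k,s}(f) N_{k,s}. Then the coefficients satisfy: c_{k,s}(f) = T_{h^{(k)}}^{[P*_even]}(Δ_{h^{(k)}}^ℓ f)(s h^{(k)}) when s is even, and c_{k,s}(f) = T_{h^{(k)}}^{[P*_odd]}(Δ_{h^{(k)}}^ℓ f)(s h^{(k)}) when s is odd, where P*_even, P*_odd are the Laurent polynomials with P_even = (z-1)^ℓ P*_even and P_odd = (z-1)^ℓ P*_odd. Moreover, for k = 0 and s ∈ I(0) one has c_{0,s}(f) = T_{h^{(0)}}^{[P_Λ]}(f)(s h^{(0)}). -/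

import Mathlib

open MeasureTheory Finset
open scoped ENNReal
noncomputable section

/-! Common definitions for Dinh Dũng, "B-spline quasi-interpolation sampling representation
and sampling recovery in Sobolev spaces of mixed smoothness". -/

/-- Cardinal B-spline of order `ℓ`: `M_1 = 1_{[0,1)}`, `M_ℓ = M_{ℓ-1} * M_1` (convolution). -/
noncomputable def bspline : ℕ → ℝ → ℝ
  | 0, _ => 0
  | 1, x => if 0 ≤ x ∧ x < 1 then 1 else 0
  | (n+2), x => ∫ t in (0:ℝ)..1, bspline (n+1) (x - t)

/-- `h^{(k)} = ℓ⁻¹ 2^{-k}`. -/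
noncomputable def hstep (ℓ k : ℕ) : ℝ := ((ℓ : ℝ))⁻¹ * ((2:ℝ) ^ k)⁻¹

/-- The univariate quasi-interpolation coefficient
`a_{k,s}(f) = Σ_{|j|≤μ} λ(j) f(h^{(k)}(s - j + ℓ/2))`. -/
noncomputable def acoef (ℓ μ : ℕ) (lam : ℤ → ℝ) (k : ℕ) (s : ℤ) (f : ℝ → ℝ) : ℝ :=
  ∑ j ∈ Finset.Icc (-(μ:ℤ)) (μ:ℤ), lam j * f (hstep ℓ k * ((s : ℝ) - (j : ℝ) + (ℓ : ℝ)/2))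

/-- The base quasi-interpolation operator `Q(f,x) = Σ_s Λ(f,s) M(x-s)`. -/
noncomputable def Qbase (ℓ μ : ℕ) (lam : ℤ → ℝ) (f : ℝ → ℝ) (x : ℝ) : ℝ :=
  ∑' s : ℤ, (∑ j ∈ Finset.Icc (-(μ:ℤ)) (μ:ℤ), lam j * f ((s:ℝ) - (j:ℝ) + (ℓ:ℝ)/2)) *
    bspline ℓ (x - (s:ℝ))

/-- The scaled operator `Q_k(f,x) = Σ_s a_{k,s}(f) M(ℓ2^k x - s)`. -/
noncomputable def Qk (ℓ μ : ℕ) (lam : ℤ → ℝ) (k : ℕ) (f : ℝ → ℝ) (x : ℝ) : ℝ :=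
  ∑' s : ℤ, acoef ℓ μ lam k s f * bspline ℓ ((ℓ:ℝ) * 2^k * x - (s:ℝ))

/-- The sequence `Λ` is even: `λ(-j) = λ(j)`. -/
def IsEvenSeq (lam : ℤ → ℝ) : Prop := ∀ j : ℤ, lam (-j) = lam j

/-- `Q` is a quasi-interpolation operator: it reproduces all polynomials of degree `≤ ℓ-1`. -/
def IsQuasiInterp (ℓ μ : ℕ) (lam : ℤ → ℝ) : Prop :=
  ∀ g : Polynomial ℝ, g.degree < (ℓ : WithBot ℕ) →
    ∀ x : ℝ, Qbase ℓ μ lam (fun y => Polynomial.eval y g) x = Polynomial.eval x g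

/-- `N_k`: the 1-periodic extension of `M(ℓ2^k ·)`. -/
noncomputable def Nper (ℓ k : ℕ) (x : ℝ) : ℝ := ∑' n : ℤ, bspline ℓ ((ℓ:ℝ) * 2^k * (x - (n:ℝ)))

/-- `N_{k,s}(x) = N_k(x - h^{(k)} s)`. -/
noncomputable def Nks (ℓ k : ℕ) (s : ℤ) (x : ℝ) : ℝ := Nper ℓ k (x - hstep ℓ k * (s:ℝ))

/-- The coefficient of `z^s` in a Laurent polynomial. -/
noncomputable def lcoeff (P : LaurentPolynomial ℝ) (s : ℤ) : ℝ := (P.coeff : ℤ →₀ ℝ) s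

/-- The shift operator `T_h^{[P]}(f)(x) = Σ_s c_s f(x + s h)` generated by a Laurent
polynomial `P(z) = Σ_s c_s z^s`. -/
noncomputable def shiftOp (P : LaurentPolynomial ℝ) (h : ℝ) (f : ℝ → ℝ) (x : ℝ) : ℝ :=
  Finsupp.sum P.coeff fun s c => c * f (x + (s : ℝ) * h)

/-- The `ℓ`-th difference operator `Δ_h^ℓ f(x) = Σ_{j=0}^ℓ (-1)^{ℓ-j} C(ℓ,j) f(x+jh)`. -/
noncomputable def deltaOp (ℓ : ℕ) (h : ℝ) (f : ℝ → ℝ) (x : ℝ) : ℝ :=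
  ∑ j ∈ Finset.range (ℓ+1), (-1:ℝ)^(ℓ - j) * (ℓ.choose j : ℝ) * f (x + (j:ℝ) * h)

/-- The multivariate shift operator `T_𝐡^{[P]}` generated by the tensor-product Laurent
polynomial `P(𝐳) = ∏_j P_j(z_j)`. -/
noncomputable def tensorShift {d : ℕ} (P : Fin d → LaurentPolynomial ℝ) (h : Fin d → ℝ)
    (f : (Fin d → ℝ) → ℝ) (x : Fin d → ℝ) : ℝ :=
  ∑ s ∈ Fintype.piFinset (fun j => (((P j).coeff : ℤ →₀ ℝ)).support),
    (∏ j, lcoeff (P j) (s j)) * f (fun j => x j + (s j : ℝ) * h j)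

/-- `P_Λ(z) = z^{ℓ/2} Σ_{|s|≤μ} λ(s) z^s`. -/
noncomputable def PLam (ℓ μ : ℕ) (lam : ℤ → ℝ) : LaurentPolynomial ℝ :=
  ∑ s ∈ Finset.Icc (-(μ:ℤ)) (μ:ℤ),
    LaurentPolynomial.C (lam s) * LaurentPolynomial.T (s + (ℓ:ℤ)/2)

/-- `P_Λ(z²)`. -/
noncomputable def PLamSq (ℓ μ : ℕ) (lam : ℤ → ℝ) : LaurentPolynomial ℝ :=
  ∑ s ∈ Finset.Icc (-(μ:ℤ)) (μ:ℤ),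
    LaurentPolynomial.C (lam s) * LaurentPolynomial.T (2*(s + (ℓ:ℤ)/2))

/-- `P'_even(z) = 2^{-ℓ+1} P_Λ(z²) Σ_{j=0}^{ℓ/2} C(ℓ,2j) z^{-2j}`. -/
noncomputable def PevenAux (ℓ μ : ℕ) (lam : ℤ → ℝ) : LaurentPolynomial ℝ :=
  LaurentPolynomial.C ((2:ℝ) ^ (1 - (ℓ:ℤ))) * PLamSq ℓ μ lam *
    ∑ j ∈ Finset.range (ℓ/2 + 1),
      LaurentPolynomial.C ((ℓ.choose (2*j) : ℝ)) * LaurentPolynomial.T (-(2*(j:ℤ)))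

/-- `P'_odd(z) = 2^{-ℓ+1} P_Λ(z²) Σ_{j=0}^{ℓ/2-1} C(ℓ,2j+1) z^{-2j-1}`. -/
noncomputable def PoddAux (ℓ μ : ℕ) (lam : ℤ → ℝ) : LaurentPolynomial ℝ :=
  LaurentPolynomial.C ((2:ℝ) ^ (1 - (ℓ:ℤ))) * PLamSq ℓ μ lam *
    ∑ j ∈ Finset.range (ℓ/2),
      LaurentPolynomial.C ((ℓ.choose (2*j+1) : ℝ)) * LaurentPolynomial.T (-(2*(j:ℤ)) - 1)

/-- `P_even = P_Λ - P'_even`. -/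
noncomputable def Peven (ℓ μ : ℕ) (lam : ℤ → ℝ) : LaurentPolynomial ℝ :=
  PLam ℓ μ lam - PevenAux ℓ μ lam

/-- `P_odd = P_Λ - P'_odd`. -/
noncomputable def Podd (ℓ μ : ℕ) (lam : ℤ → ℝ) : LaurentPolynomial ℝ :=
  PLam ℓ μ lam - PoddAux ℓ μ lam

/-- A symmetric Laurent polynomial: its coefficients are symmetric about some
(possibly half-integer) center `c/2`. -/
def IsSymmLaurent (P : LaurentPolynomial ℝ) : Prop :=
  ∃ c : ℤ, ∀ s : ℤ, lcoeff P s = lcoeff P (c - s)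

/-- The unit cube `[0,1]^d`, a model of the torus `𝕋^d`. -/
def cube (d : ℕ) : Set (Fin d → ℝ) := Set.univ.pi fun _ => Set.Icc (0:ℝ) 1

/-- Lebesgue measure restricted to the unit cube. -/
noncomputable def μcube (d : ℕ) : Measure (Fin d → ℝ) := volume.restrict (cube d)

/-- `f` is 1-periodic in each variable, i.e. a function on the torus `𝕋^d`. -/
def PeriodicTd {d : ℕ} (f : (Fin d → ℝ) → ℝ) : Prop :=
  ∀ (x : Fin d → ℝ) (j : Fin d), f (Function.update x j (x j + 1)) = f x

/-- The univariate operator `Q_k` applied in the `j`-th variable. -/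
noncomputable def QkCoord (ℓ μ : ℕ) (lam : ℤ → ℝ) {d : ℕ} (j : Fin d) (k : ℕ)
    (f : (Fin d → ℝ) → ℝ) (x : Fin d → ℝ) : ℝ :=
  ∑' s : ℤ, (∑ i ∈ Finset.Icc (-(μ:ℤ)) (μ:ℤ), lam i *
      f (Function.update x j (hstep ℓ k * ((s:ℝ) - (i:ℝ) + (ℓ:ℝ)/2)))) *
    bspline ℓ ((ℓ:ℝ) * 2^k * x j - (s:ℝ))

/-- `Q_{k} - Q_{k-1}` in the `j`-th variable, with the convention `Q_{-1} = 0`. -/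
noncomputable def qdiffCoord (ℓ μ : ℕ) (lam : ℤ → ℝ) {d : ℕ} (j : Fin d) :
    ℕ → ((Fin d → ℝ) → ℝ) → (Fin d → ℝ) → ℝ
  | 0, f => QkCoord ℓ μ lam j 0 f
  | (k+1), f => fun x => QkCoord ℓ μ lam j (k+1) f x - QkCoord ℓ μ lam j k f x

/-- The mixed operator `Q_𝐤 = ∏_i Q_{k_i}`. -/
noncomputable def Qmix (ℓ μ : ℕ) (lam : ℤ → ℝ) {d : ℕ} (k : Fin d → ℕ)
    (f : (Fin d → ℝ) → ℝ) : (Fin d → ℝ) → ℝ :=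
  (List.finRange d).foldr (fun j g => QkCoord ℓ μ lam j (k j) g) f

/-- The mixed operator `q_𝐤 = ∏_i (Q_{k_i} - Q_{k_i-1})`. -/
noncomputable def qmix (ℓ μ : ℕ) (lam : ℤ → ℝ) {d : ℕ} (k : Fin d → ℕ)
    (f : (Fin d → ℝ) → ℝ) : (Fin d → ℝ) → ℝ :=
  (List.finRange d).foldr (fun j g => qdiffCoord ℓ μ lam j (k j) g) f

/-- The `𝐬`-th Fourier coefficient of a function on `𝕋^d`. -/
noncomputable def fourierCoeffCube (d : ℕ) (f : (Fin d → ℝ) → ℝ) (s : Fin d → ℤ) : ℂ :=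
  ∫ x in cube d, (f x : ℂ) *
    Complex.exp (-(2 * Real.pi * Complex.I) * (∑ j, (s j : ℂ) * (x j : ℂ)))

/-- `Σ_𝐬 f̂(𝐬) ∏_j (1+|s_j|²)^{r/2} e^{2πi(𝐬,x)}`. -/
noncomputable def WKernel (d : ℕ) (r : ℝ) (f : (Fin d → ℝ) → ℝ) (x : Fin d → ℝ) : ℂ :=
  ∑' s : Fin d → ℤ, fourierCoeffCube d f s * (((∏ j, ((1:ℝ) + (s j : ℝ)^2) ^ (r/2)) : ℝ) : ℂ) *
    Complex.exp ((2 * Real.pi * Complex.I) * (∑ j, (s j : ℂ) * (x j : ℂ)))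

/-- The norm of the Sobolev space `W^r_p` of mixed smoothness `r` on `𝕋^d`. -/
noncomputable def WNorm (d : ℕ) (r : ℝ) (p : ℝ≥0∞) (f : (Fin d → ℝ) → ℝ) : ℝ≥0∞ :=
  eLpNorm (WKernel d r f) p (μcube d)

/-- The Littlewood–Paley square function `(Σ_𝐤 |2^{r|𝐤|₁} q_𝐤(f)|²)^{1/2}`. -/
noncomputable def lpSqFn (d ℓ μ : ℕ) (lam : ℤ → ℝ) (r : ℝ) (f : (Fin d → ℝ) → ℝ)
    (x : Fin d → ℝ) : ℝ :=
  Real.sqrt (∑' k : Fin d → ℕ, ((2:ℝ) ^ (r * ∑ j, (k j : ℝ)) * qmix ℓ μ lam k f x) ^ 2)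

/-- The Smolyak-type sampling operator `R_m(f) = Σ_{|𝐤|₁ ≤ m} q_𝐤(f)`. -/
noncomputable def Rop (ℓ μ : ℕ) (lam : ℤ → ℝ) {d : ℕ} (m : ℕ) (f : (Fin d → ℝ) → ℝ)
    (x : Fin d → ℝ) : ℝ :=
  ∑ k ∈ (Fintype.piFinset fun _ : Fin d => Finset.range (m+1)).filter
      (fun k => ∑ j, k j ≤ m), qmix ℓ μ lam k f x

/-- The unit ball `U^r_p` of `W^r_p` (represented by continuous periodic functions). -/
def unitBallW (d : ℕ) (r p : ℝ) : Set ((Fin d → ℝ) → ℝ) :=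
  {f | Continuous f ∧ PeriodicTd f ∧ WNorm d r (ENNReal.ofReal p) f ≤ 1}

/-- The sampling width `r_n(F, L_q)`. -/
noncomputable def sampWidth (d n : ℕ) (q : ℝ≥0∞) (F : Set ((Fin d → ℝ) → ℝ)) : ℝ≥0∞ :=
  ⨅ (X : Fin n → (Fin d → ℝ)) (Φ : Fin n → (Fin d → ℝ) → ℝ),
    ⨆ f ∈ F, eLpNorm (fun x => f x - ∑ j, f (X j) * Φ j x) q (μcube d)

/-- The Smolyak grid `G^d(m) = {2^{-𝐤}𝐬 : 𝐤 ∈ ℕ^d, |𝐤|₁ = m, 0 ≤ s_j ≤ 2^{k_j}-1}`. -/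
noncomputable def smolyakGrid (d m : ℕ) : Finset (Fin d → ℝ) := by
  classical
  exact ((Fintype.piFinset fun _ : Fin d => Finset.Icc 1 m).filter fun k => ∑ j, k j = m).biUnion
    fun k => (Fintype.piFinset fun j => Finset.range (2 ^ (k j))).image
      fun s => fun j => (s j : ℝ) / 2 ^ (k j)

/-- The Smolyak sampling width `r_n^s(F, L_q)`. -/
noncomputable def smolyakWidth (d n : ℕ) (q : ℝ≥0∞) (F : Set ((Fin d → ℝ) → ℝ)) : ℝ≥0∞ :=
  ⨅ (m : ℕ) (_ : (smolyakGrid d m).card ≤ n) (Φ : (Fin d → ℝ) → (Fin d → ℝ) → ℝ),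
    ⨆ f ∈ F, eLpNorm (fun x => f x - ∑ y ∈ smolyakGrid d m, f y * Φ y x) q (μcube d)

/-- The `a`-th difference in the `j`-th coordinate. -/
noncomputable def deltaCoord {d : ℕ} (a : ℕ) (j : Fin d) (t : ℝ)
    (f : (Fin d → ℝ) → ℝ) (x : Fin d → ℝ) : ℝ :=
  ∑ i ∈ Finset.range (a+1), (-1:ℝ)^(a - i) * (a.choose i : ℝ) *
    f (Function.update x j (x j + (i:ℝ) * t))

/-- The mixed `(a,u)`-th difference `Δ_𝐡^{a,u} = ∏_{i∈u} Δ_{h_i}^a`. -/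
noncomputable def mixedDelta {d : ℕ} (a : ℕ) (u : Finset (Fin d)) (h : Fin d → ℝ)
    (f : (Fin d → ℝ) → ℝ) : (Fin d → ℝ) → ℝ :=
  u.toList.foldr (fun j g => deltaCoord a j (h j) g) f

/-- The mixed modulus of smoothness `ω_a^u(f,𝐭)_p`. -/
noncomputable def besovModulus (d a : ℕ) (u : Finset (Fin d)) (p : ℝ≥0∞)
    (t : Fin d → ℝ) (f : (Fin d → ℝ) → ℝ) : ℝ≥0∞ :=
  ⨆ h : {h : Fin d → ℝ // ∀ i ∈ u, |h i| < t i}, eLpNorm (mixedDelta a u h.1 f) p (μcube d)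

/-- The Besov quasi-seminorm `|f|_{B^{r,u}_{p,θ}}`. -/
noncomputable def besovSemi (d a : ℕ) (p θ : ℝ≥0∞) (r : ℝ) (u : Finset (Fin d))
    (f : (Fin d → ℝ) → ℝ) : ℝ≥0∞ :=
  if θ = ⊤ then
    ⨆ (t : Fin d → ℝ) (_ : t ∈ cube d),
      (∏ i ∈ u, ENNReal.ofReal ((t i) ^ (-r))) * besovModulus d a u p t f
  else
    (∫⁻ t in cube d,
      ((∏ i ∈ u, ENNReal.ofReal ((t i) ^ (-r))) * besovModulus d a u p t f) ^ θ.toReal *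
        (∏ i ∈ u, ENNReal.ofReal (t i)⁻¹)) ^ (1/θ.toReal)

/-- The Besov quasi-norm `‖f‖_{B^r_{p,θ}} = Σ_{u⊂[d]} |f|_{B^{r,u}_{p,θ}}`. -/
noncomputable def besovNorm (d a : ℕ) (p θ : ℝ≥0∞) (r : ℝ)
    (f : (Fin d → ℝ) → ℝ) : ℝ≥0∞ :=
  ∑ u : Finset (Fin d), besovSemi d a p θ r u f

/-- The sequence quasi-norm `(Σ_𝐤 2^{r|𝐤|₁θ} ‖g_𝐤‖_p^θ)^{1/θ}` (sup when `θ = ∞`). -/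
noncomputable def seqNormB (d : ℕ) (p θ : ℝ≥0∞) (r : ℝ)
    (g : (Fin d → ℕ) → (Fin d → ℝ) → ℝ) : ℝ≥0∞ :=
  if θ = ⊤ then
    ⨆ k : Fin d → ℕ, ENNReal.ofReal ((2:ℝ) ^ (r * ∑ j, (k j : ℝ))) * eLpNorm (g k) p (μcube d)
  else
    (∑' k : Fin d → ℕ,
      (ENNReal.ofReal ((2:ℝ) ^ (r * ∑ j, (k j : ℝ))) * eLpNorm (g k) p (μcube d)) ^ θ.toReal) ^
      (1/θ.toReal)

/-- The B-spline sum `q_𝐤 = Σ_{𝐬 ∈ I(𝐤)} c_{𝐤,𝐬} N_{𝐤,𝐬}` with given coefficients. -/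
noncomputable def bsplineSeriesTerm (ℓ : ℕ) {d : ℕ} (c : (Fin d → ℕ) → (Fin d → ℕ) → ℝ)
    (k : Fin d → ℕ) (x : Fin d → ℝ) : ℝ :=
  ∑ s ∈ Fintype.piFinset (fun j => Finset.range (ℓ * 2 ^ (k j))),
    c k s * ∏ j, Nks ℓ (k j) (s j : ℤ) (x j)

/-! ### B-splines: integrability, support, refinement equation -/

theorem intervalIntegrable_bspline (n : ℕ) (a b : ℝ) :
    IntervalIntegrable (bspline (n + 1)) volume a b := by
  induction n generalizing a b with
  | zero =>
    have h : bspline (0 + 1) = Set.indicator (Set.Ico (0 : ℝ) 1) (fun _ => (1 : ℝ)) := by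
      ext x
      simp [bspline, Set.indicator_apply]
    rw [h]
    exact ((integrable_indicator_iff measurableSet_Ico).mpr
      (integrableOn_const (by simp))).intervalIntegrable
  | succ n ih =>
    have h : bspline (n + 1 + 1) = fun x => (∫ t in (0 : ℝ)..x, bspline (n + 1) t)
        - ∫ t in (0 : ℝ)..(x - 1), bspline (n + 1) t := by
      ext x
      rw [intervalIntegral.integral_interval_sub_left (ih _ _) (ih _ _)]
      simp [bspline, intervalIntegral.integral_comp_sub_left]
    rw [h]
    have hc := intervalIntegral.continuous_primitive ih 0
    exact (hc.sub (hc.comp (continuous_id.sub continuous_const))).intervalIntegrable a b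

theorem bspline_eq_zero (n : ℕ) {x : ℝ} (hx : x < 0 ∨ (n : ℝ) < x) : bspline n x = 0 := by
  induction n generalizing x with
  | zero => rfl
  | succ n ih =>
    cases n with
    | zero =>
      simp only [bspline, ite_eq_right_iff, one_ne_zero, imp_false]
      rintro ⟨h0, h1⟩
      push_cast at hx
      rcases hx with hx | hx <;> linarith
    | succ n =>
      simp only [bspline]
      rw [intervalIntegral.integral_congr (g := fun _ => (0 : ℝ))]
      · simp
      · intro t ht
        rw [Set.uIcc_of_le zero_le_one] at ht
        refine ih ?_
        push_cast at hx ⊢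
        rcases hx with hx | hx
        · left; linarith [ht.1]
        · right; linarith [ht.2]

theorem bspline_refinement (n : ℕ) (x : ℝ) :
    bspline (n + 1) x = (2 : ℝ)⁻¹ ^ n *
      ∑ j ∈ Finset.range (n + 2), ((n + 1).choose j : ℝ) * bspline (n + 1) (2 * x - j) := by
  induction n generalizing x with
  | zero =>
    simp only [bspline, Finset.sum_range_succ]
    by_cases h0 : 0 ≤ x <;> by_cases h1 : x < 1 <;> by_cases h2 : 2 * x < 1 <;>
      simp [h0, h1, h2] <;> grind
  | succ n ih =>
    have hint : ∀ (y a b : ℝ), IntervalIntegrable (fun t => bspline (n + 1) (y - t)) volume a b :=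
      fun y a b => by
        simpa using (intervalIntegrable_bspline n (y - a) (y - b)).comp_sub_left (c := y)
    have key : ∀ j : ℕ, ∫ t in (0 : ℝ)..1, bspline (n + 1) (2 * (x - t) - j)
        = 2⁻¹ * (bspline (n + 2) (2 * x - j) + bspline (n + 2) (2 * x - j - 1)) := by
      intro j
      have h1 : ∫ t in (0 : ℝ)..1, bspline (n + 1) (2 * (x - t) - j)
          = ∫ t in (0 : ℝ)..1, (fun u => bspline (n + 1) (2 * x - j - u)) (2 * t) := by
        congr 1; ext t; congr 1; ring
      refine h1.trans ((intervalIntegral.integral_comp_mul_left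
        (fun u => bspline (n + 1) (2 * x - j - u)) two_ne_zero).trans ?_)
      rw [smul_eq_mul]
      congr 1
      rw [mul_zero, mul_one, ← intervalIntegral.integral_add_adjacent_intervals
        (hint _ 0 1) (hint _ 1 2)]
      congr 1
      have h2 : bspline (n + 2) (2 * x - j - 1)
          = ∫ t in (0 : ℝ)..1, (fun u => bspline (n + 1) (2 * x - j - u)) (t + 1) := by
        simp only [bspline]
        congr 1; ext t; congr 1; ring
      rw [h2]
      refine Eq.trans ?_ (intervalIntegral.integral_comp_add_right
        (fun u => bspline (n + 1) (2 * x - j - u)) 1).symm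
      norm_num
    have hlhs : bspline (n + 1 + 1) x = ∫ t in (0 : ℝ)..1, bspline (n + 1) (x - t) := rfl
    rw [hlhs]
    simp_rw [fun t : ℝ => ih (x - t)]
    rw [intervalIntegral.integral_const_mul, intervalIntegral.integral_finsetSum]
    · simp_rw [intervalIntegral.integral_const_mul, key]
      rw [pow_succ, mul_assoc]
      congr 1
      rw [Finset.sum_range_succ' _ (n + 2)]
      have e : ∀ j : ℕ, ((n + 1 + 1).choose (j + 1) : ℝ)
          = ((n + 1).choose j : ℝ) + ((n + 1).choose (j + 1) : ℝ) := by
        intro j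
        rw [Nat.choose_succ_succ]; push_cast; ring
      have h3 : ∑ j ∈ Finset.range (n + 2),
            ((n + 1).choose (j + 1) : ℝ) * bspline (n + 2) (2 * x - ((j + 1 : ℕ) : ℝ))
            + bspline (n + 2) (2 * x)
          = ∑ j ∈ Finset.range (n + 2), ((n + 1).choose j : ℝ) * bspline (n + 2) (2 * x - j) := by
        rw [Finset.sum_range_succ, Finset.sum_range_succ' _ (n + 1)]
        simp
      simp_rw [e, add_mul]
      rw [Finset.sum_add_distrib, add_assoc]
      have h4 : ((n + 1 + 1).choose 0 : ℝ) * bspline (n + 1 + 1) (2 * x - ((0 : ℕ) : ℝ))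
          = bspline (n + 2) (2 * x) := by simp
      rw [h4, h3, mul_add, Finset.mul_sum, Finset.mul_sum, ← Finset.sum_add_distrib]
      refine Finset.sum_congr rfl fun j _ => ?_
      have h5 : 2 * x - ((j + 1 : ℕ) : ℝ) = 2 * x - j - 1 := by push_cast; ring
      rw [h5]; ring
    · intro j _
      refine IntervalIntegrable.const_mul ?_ _
      have h := (intervalIntegrable_bspline n (2 * x - j) (2 * x - j - 2)).comp_sub_left
        (c := 2 * x - j)
      have h' := h.comp_mul_left (c := 2)
      norm_num at h'
      refine h'.congr ?_
      intro t _
      simp only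
      congr 1; ring

theorem finite_support_bspline_sub (ℓ : ℕ) (y : ℝ) :
    (Function.support fun s : ℤ => bspline ℓ (y - s)).Finite := by
  refine (Set.finite_Icc ⌊y - ℓ⌋ ⌈y⌉).subset fun s hs => ?_
  have h := mt (bspline_eq_zero ℓ (x := y - s)) hs
  push Not at h
  constructor
  · have : (⌊y - ℓ⌋ : ℝ) ≤ s := (Int.floor_le _).trans (by linarith)
    exact_mod_cast this
  · have : (s : ℝ) ≤ ⌈y⌉ := le_trans (by linarith) (Int.le_ceil y)
    exact_mod_cast this

/-! ### Rearranging sums over `ℤ` -/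

theorem tsum_int_mul_eq_sum_range (N : ℕ) (hN : 0 < N) (a v : ℤ → ℝ)
    (ha : ∀ s n : ℤ, a (s + N * n) = a s) (hv : (Function.support v).Finite) :
    ∑' s : ℤ, a s * v s = ∑ r ∈ Finset.range N, a r * ∑' n : ℤ, v (r + N * n) := by
  have : NeZero N := ⟨hN.ne'⟩
  have hs : Summable fun s : ℤ => a s * v s :=
    summable_of_hasFiniteSupport (hv.subset (Function.support_mul_subset_right _ _))
  let e : Fin N × ℤ ≃ ℤ := (Equiv.prodComm _ _).trans (Int.divModEquiv N).symm
  have he : ∀ r : Fin N, ∀ n : ℤ, e (r, n) = (r : ℕ) + N * n := by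
    intro r n
    simp [e, Int.divModEquiv]
    ring
  rw [← e.tsum_eq, Summable.tsum_prod (f := fun p => a (e p) * v (e p)) (e.summable_iff.mpr hs),
    tsum_fintype, Finset.sum_range]
  refine Finset.sum_congr rfl fun r _ => ?_
  simp_rw [he, ha, tsum_mul_left]

theorem tsum_int_mul_sum_dilate (m : ℕ) (c : ℕ → ℝ) (a v : ℤ → ℝ)
    (hv : (Function.support v).Finite) :
    ∑' s : ℤ, a s * ∑ j ∈ Finset.range m, c j * v (2 * s + j)
      = ∑' t : ℤ, (∑ j ∈ Finset.range m,
          if (2 : ℤ) ∣ t - j then c j * a ((t - j) / 2) else 0) * v t := by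
  have hinj : ∀ j : ℕ, Function.Injective fun s : ℤ => 2 * s + (j : ℤ) := by
    intro j s t h
    simp only at h
    lia
  simp_rw [Finset.mul_sum, Finset.sum_mul]
  rw [Summable.tsum_finsetSum, Summable.tsum_finsetSum]
  · refine Finset.sum_congr rfl fun j _ => ?_
    refine Eq.trans ?_ ((hinj j).tsum_eq ?_)
    · refine tsum_congr fun s => ?_
      simp
      ring
    · intro t ht
      by_contra hr
      apply ht
      simp only
      rw [if_neg, zero_mul]
      rintro ⟨u, hu⟩
      exact hr ⟨u, by simp only; lia⟩
  · intro j _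
    exact summable_of_hasFiniteSupport (hv.subset (Function.support_mul_subset_right _ _))
  · intro j _
    refine summable_of_hasFiniteSupport ((hv.preimage (hinj j).injOn).subset fun s hs => ?_)
    simp only [Function.mem_support, ne_eq, mul_eq_zero, not_or] at hs
    exact hs.2.2

theorem sum_range_two_mul_add_one (m : ℕ) (g : ℕ → ℝ) :
    ∑ j ∈ Finset.range (2 * m + 1), g j
      = ∑ i ∈ Finset.range (m + 1), g (2 * i) + ∑ i ∈ Finset.range m, g (2 * i + 1) := by
  induction m with
  | zero => simp
  | succ m ih =>
    rw [show 2 * (m + 1) + 1 = 2 * m + 1 + 1 + 1 by ring, Finset.sum_range_succ,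
      Finset.sum_range_succ, ih, Finset.sum_range_succ _ (m + 1), Finset.sum_range_succ (fun i => g (2 * i + 1)) m,
      show 2 * (m + 1) = 2 * m + 1 + 1 by ring]
    ring

/-! ### Shift operators -/

/-- The shift operator as an additive homomorphism in the Laurent polynomial. -/
noncomputable def shiftHom (h : ℝ) (f : ℝ → ℝ) (x : ℝ) : LaurentPolynomial ℝ →+ ℝ where
  toFun P := shiftOp P h f x
  map_zero' := by simp [shiftOp]
  map_add' P Q := by
    simp only [shiftOp, AddMonoidAlgebra.coeff_add]
    exact Finsupp.sum_add_index' (by simp) (by intros; ring)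

theorem shiftOp_add (P Q : LaurentPolynomial ℝ) (h : ℝ) (f : ℝ → ℝ) (x : ℝ) :
    shiftOp (P + Q) h f x = shiftOp P h f x + shiftOp Q h f x :=
  (shiftHom h f x).map_add P Q

theorem shiftOp_sub (P Q : LaurentPolynomial ℝ) (h : ℝ) (f : ℝ → ℝ) (x : ℝ) :
    shiftOp (P - Q) h f x = shiftOp P h f x - shiftOp Q h f x :=
  (shiftHom h f x).map_sub P Q

theorem shiftOp_sum {ι : Type*} (S : Finset ι) (P : ι → LaurentPolynomial ℝ) (h : ℝ)
    (f : ℝ → ℝ) (x : ℝ) :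
    shiftOp (∑ i ∈ S, P i) h f x = ∑ i ∈ S, shiftOp (P i) h f x :=
  map_sum (shiftHom h f x) P S

theorem shiftOp_C_mul_T (c : ℝ) (n : ℤ) (h : ℝ) (f : ℝ → ℝ) (x : ℝ) :
    shiftOp (LaurentPolynomial.C c * LaurentPolynomial.T n) h f x = c * f (x + n * h) := by
  rw [← LaurentPolynomial.single_eq_C_mul_T]
  simp only [shiftOp, AddMonoidAlgebra.coeff_single]
  exact Finsupp.sum_single_index (by simp)

theorem shiftOp_C_mul (c : ℝ) (P : LaurentPolynomial ℝ) (h : ℝ) (f : ℝ → ℝ) (x : ℝ) :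
    shiftOp (LaurentPolynomial.C c * P) h f x = c * shiftOp P h f x := by
  induction P using LaurentPolynomial.induction_on' with
  | add P Q hP hQ => rw [mul_add, shiftOp_add, shiftOp_add, hP, hQ, mul_add]
  | C_mul_T n a => rw [← mul_assoc, ← map_mul, shiftOp_C_mul_T, shiftOp_C_mul_T, mul_assoc]

theorem shiftOp_T_mul (n : ℤ) (P : LaurentPolynomial ℝ) (h : ℝ) (f : ℝ → ℝ) (x : ℝ) :
    shiftOp (LaurentPolynomial.T n * P) h f x = shiftOp P h f (x + n * h) := by
  induction P using LaurentPolynomial.induction_on' with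
  | add P Q hP hQ => rw [mul_add, shiftOp_add, shiftOp_add, hP, hQ]
  | C_mul_T m a =>
    rw [mul_left_comm, ← LaurentPolynomial.T_add, shiftOp_C_mul_T, shiftOp_C_mul_T]
    congr 2
    push_cast
    ring

theorem shiftOp_mul (P R : LaurentPolynomial ℝ) (h : ℝ) (f : ℝ → ℝ) (x : ℝ) :
    shiftOp (P * R) h f x = shiftOp P h (shiftOp R h f) x := by
  induction P using LaurentPolynomial.induction_on' with
  | add P Q hP hQ => rw [add_mul, shiftOp_add, shiftOp_add, hP, hQ]
  | C_mul_T n a => rw [mul_assoc, shiftOp_C_mul, shiftOp_T_mul, shiftOp_C_mul_T]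

theorem shiftOp_T_sub_one_pow (ℓ : ℕ) (h : ℝ) (f : ℝ → ℝ) :
    shiftOp ((LaurentPolynomial.T 1 - 1) ^ ℓ) h f = deltaOp ℓ h f := by
  ext x
  have e : (LaurentPolynomial.T 1 - 1 : LaurentPolynomial ℝ) ^ ℓ
      = ∑ j ∈ Finset.range (ℓ + 1), LaurentPolynomial.C ((-1) ^ (ℓ - j) * (ℓ.choose j : ℝ))
          * LaurentPolynomial.T (j : ℤ) := by
    rw [sub_eq_add_neg, add_pow]
    refine Finset.sum_congr rfl fun j _ => ?_
    rw [LaurentPolynomial.T_pow, mul_one, map_mul, map_pow, map_neg, map_one, map_natCast]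
    ring
  rw [e, shiftOp_sum]
  simp only [deltaOp, shiftOp_C_mul_T, Int.cast_natCast]

/-! ### Quasi-interpolation coefficients as shifts -/

theorem sum_Icc_neg_comm (μ : ℕ) (g : ℤ → ℝ) :
    ∑ j ∈ Finset.Icc (-(μ : ℤ)) μ, g (-j) = ∑ j ∈ Finset.Icc (-(μ : ℤ)) μ, g j :=
  Finset.sum_nbij' Neg.neg Neg.neg (by simp; lia) (by simp; lia) (by simp) (by simp) (by simp)

theorem acoef_eq_sum_add (ℓ μ : ℕ) (lam : ℤ → ℝ) (hlam : IsEvenSeq lam) (k : ℕ) (s : ℤ)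
    (f : ℝ → ℝ) :
    acoef ℓ μ lam k s f = ∑ j ∈ Finset.Icc (-(μ : ℤ)) μ,
      lam j * f (hstep ℓ k * ((s : ℝ) + j + (ℓ : ℝ) / 2)) := by
  rw [acoef, ← sum_Icc_neg_comm]
  refine Finset.sum_congr rfl fun j _ => ?_
  rw [hlam]
  push_cast
  rw [sub_neg_eq_add]

theorem acoef_eq_shiftOp_PLam (ℓ μ : ℕ) (hℓe : Even ℓ) (lam : ℤ → ℝ) (hlam : IsEvenSeq lam)
    (k : ℕ) (s : ℤ) (f : ℝ → ℝ) :
    acoef ℓ μ lam k s f = shiftOp (PLam ℓ μ lam) (hstep ℓ k) f (s * hstep ℓ k) := by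
  obtain ⟨m, rfl⟩ := hℓe.two_dvd
  rw [acoef_eq_sum_add _ _ _ hlam, PLam, shiftOp_sum]
  refine Finset.sum_congr rfl fun j _ => ?_
  rw [shiftOp_C_mul_T]
  congr 2
  push_cast [Int.mul_ediv_cancel_left]
  ring

theorem hstep_eq_two_mul (ℓ k : ℕ) : hstep ℓ k = 2 * hstep ℓ (k + 1) := by
  simp only [hstep, pow_succ, mul_inv]
  ring

theorem acoef_eq_shiftOp_PLamSq (ℓ μ : ℕ) (hℓe : Even ℓ) (lam : ℤ → ℝ) (hlam : IsEvenSeq lam)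
    (k : ℕ) (s : ℤ) (f : ℝ → ℝ) :
    acoef ℓ μ lam k s f
      = shiftOp (PLamSq ℓ μ lam) (hstep ℓ (k + 1)) f (2 * s * hstep ℓ (k + 1)) := by
  obtain ⟨m, rfl⟩ := hℓe.two_dvd
  rw [acoef_eq_sum_add _ _ _ hlam, PLamSq, shiftOp_sum]
  refine Finset.sum_congr rfl fun j _ => ?_
  rw [shiftOp_C_mul_T, hstep_eq_two_mul]
  congr 2
  push_cast [Int.mul_ediv_cancel_left]
  ring

theorem acoef_add_period (ℓ μ : ℕ) (hℓ : 0 < ℓ) (lam : ℤ → ℝ) (k : ℕ) (f : ℝ → ℝ)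
    (hfp : Function.Periodic f 1) (s n : ℤ) :
    acoef ℓ μ lam k (s + (ℓ * 2 ^ k : ℕ) * n) f = acoef ℓ μ lam k s f := by
  have hℓ' : (ℓ : ℝ) ≠ 0 := by positivity
  refine Finset.sum_congr rfl fun j _ => ?_
  congr 1
  refine Eq.trans (congrArg f ?_) (hfp.int_mul n _)
  simp only [hstep]
  push_cast
  field_simp
  ring

/-- The coefficients of `Q_k(f)` in the B-spline expansion of level `k + 1`. -/
noncomputable def refinedCoef (ℓ μ : ℕ) (lam : ℤ → ℝ) (k : ℕ) (t : ℤ) (f : ℝ → ℝ) : ℝ :=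
  ∑ j ∈ Finset.range (ℓ + 1), if (2 : ℤ) ∣ t - j then
    ((2 : ℝ) ^ (1 - (ℓ : ℤ)) * (ℓ.choose j : ℝ)) * acoef ℓ μ lam k ((t - j) / 2) f else 0

theorem refinedCoef_even (ℓ μ : ℕ) (hℓe : Even ℓ) (lam : ℤ → ℝ) (hlam : IsEvenSeq lam)
    (k : ℕ) (t : ℤ) (ht : Even t) (f : ℝ → ℝ) :
    refinedCoef ℓ μ lam k t f
      = shiftOp (PevenAux ℓ μ lam) (hstep ℓ (k + 1)) f (t * hstep ℓ (k + 1)) := by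
  rw [PevenAux, mul_comm _ (Finset.sum _ _), shiftOp_mul, shiftOp_sum, refinedCoef]
  obtain ⟨m, hm⟩ := hℓe.two_dvd
  obtain ⟨u, rfl⟩ := ht.two_dvd
  rw [show ℓ + 1 = 2 * m + 1 by rw [hm], show ℓ / 2 = m by lia, sum_range_two_mul_add_one]
  rw [Finset.sum_eq_zero (s := Finset.range m), add_zero]
  · refine Finset.sum_congr rfl fun j _ => ?_
    rw [if_pos (by push_cast; lia), shiftOp_C_mul_T, shiftOp_C_mul,
      show (2 * u - ((2 * j : ℕ) : ℤ)) / 2 = u - j by push_cast; lia,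
      acoef_eq_shiftOp_PLamSq _ _ hℓe _ hlam, mul_assoc, mul_left_comm]
    congr 4
    push_cast
    ring
  · intro j _
    rw [if_neg (by push_cast; lia)]

theorem refinedCoef_odd (ℓ μ : ℕ) (hℓe : Even ℓ) (lam : ℤ → ℝ) (hlam : IsEvenSeq lam)
    (k : ℕ) (t : ℤ) (ht : ¬ Even t) (f : ℝ → ℝ) :
    refinedCoef ℓ μ lam k t f
      = shiftOp (PoddAux ℓ μ lam) (hstep ℓ (k + 1)) f (t * hstep ℓ (k + 1)) := by
  rw [PoddAux, mul_comm _ (Finset.sum _ _), shiftOp_mul, shiftOp_sum, refinedCoef]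
  obtain ⟨m, hm⟩ := hℓe.two_dvd
  obtain ⟨u, rfl⟩ := Int.not_even_iff_odd.mp ht
  rw [show ℓ + 1 = 2 * m + 1 by rw [hm], show ℓ / 2 = m by lia, sum_range_two_mul_add_one]
  rw [Finset.sum_eq_zero (s := Finset.range (m + 1)), zero_add]
  · refine Finset.sum_congr rfl fun j _ => ?_
    rw [if_pos (by push_cast; lia), shiftOp_C_mul_T, shiftOp_C_mul,
      show (2 * u + 1 - ((2 * j + 1 : ℕ) : ℤ)) / 2 = u - j by push_cast; lia,
      acoef_eq_shiftOp_PLamSq _ _ hℓe _ hlam, mul_assoc, mul_left_comm]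
    congr 4
    push_cast
    ring
  · intro j _
    rw [if_neg (by push_cast; lia)]

theorem refinedCoef_add_period (ℓ μ : ℕ) (hℓ : 0 < ℓ) (lam : ℤ → ℝ) (k : ℕ) (f : ℝ → ℝ)
    (hfp : Function.Periodic f 1) (t n : ℤ) :
    refinedCoef ℓ μ lam k (t + (ℓ * 2 ^ (k + 1) : ℕ) * n) f = refinedCoef ℓ μ lam k t f := by
  have e : ∀ j : ℕ, t + (ℓ * 2 ^ (k + 1) : ℕ) * n - (j : ℤ)
      = (t - j) + 2 * ((ℓ * 2 ^ k : ℕ) * n) := by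
    intro j; push_cast; ring
  refine Finset.sum_congr rfl fun j _ => ?_
  simp only [e, dvd_add_left (dvd_mul_right (2 : ℤ) _), Int.add_mul_ediv_left _ _ two_ne_zero,
    acoef_add_period _ _ hℓ _ _ _ hfp]

/-! ### Expansions of `Q_k` -/

theorem Nks_eq_tsum (ℓ : ℕ) (hℓ : 0 < ℓ) (k : ℕ) (s : ℤ) (x : ℝ) :
    Nks ℓ k s x
      = ∑' n : ℤ, bspline ℓ ((ℓ : ℝ) * 2 ^ k * x - ((s + (ℓ * 2 ^ k : ℕ) * n : ℤ) : ℝ)) := by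
  have hℓ' : (ℓ : ℝ) ≠ 0 := by positivity
  simp only [Nks, Nper]
  refine tsum_congr fun n => ?_
  congr 1
  simp only [hstep]
  push_cast
  field_simp
  ring

theorem tsum_mul_bspline_eq_sum_Nks (ℓ : ℕ) (hℓ : 0 < ℓ) (k : ℕ) (a : ℤ → ℝ)
    (ha : ∀ s n : ℤ, a (s + (ℓ * 2 ^ k : ℕ) * n) = a s) (x : ℝ) :
    ∑' s : ℤ, a s * bspline ℓ ((ℓ : ℝ) * 2 ^ k * x - s)
      = ∑ s ∈ Finset.range (ℓ * 2 ^ k), a s * Nks ℓ k s x := by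
  rw [tsum_int_mul_eq_sum_range (ℓ * 2 ^ k) (by positivity) a _ ha
    (finite_support_bspline_sub ℓ _)]
  refine Finset.sum_congr rfl fun s _ => ?_
  rw [Nks_eq_tsum ℓ hℓ]

theorem Qk_eq_sum_acoef (ℓ μ : ℕ) (hℓ : 0 < ℓ) (lam : ℤ → ℝ) (k : ℕ) (f : ℝ → ℝ)
    (hfp : Function.Periodic f 1) (x : ℝ) :
    Qk ℓ μ lam k f x
      = ∑ s ∈ Finset.range (ℓ * 2 ^ k), acoef ℓ μ lam k s f * Nks ℓ k s x :=
  tsum_mul_bspline_eq_sum_Nks ℓ hℓ k (fun s => acoef ℓ μ lam k s f)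
    (acoef_add_period ℓ μ hℓ lam k f hfp) x

theorem Qk_eq_sum_refinedCoef (ℓ μ : ℕ) (hℓ : 0 < ℓ) (lam : ℤ → ℝ) (k : ℕ) (f : ℝ → ℝ)
    (hfp : Function.Periodic f 1) (x : ℝ) :
    Qk ℓ μ lam k f x
      = ∑ s ∈ Finset.range (ℓ * 2 ^ (k + 1)),
          refinedCoef ℓ μ lam k s f * Nks ℓ (k + 1) s x := by
  rw [← tsum_mul_bspline_eq_sum_Nks ℓ hℓ (k + 1) (fun s => refinedCoef ℓ μ lam k s f)
    (refinedCoef_add_period ℓ μ hℓ lam k f hfp) x]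
  simp only [refinedCoef]
  rw [← tsum_int_mul_sum_dilate (ℓ + 1) _ (fun s => acoef ℓ μ lam k s f)
    (fun t : ℤ => bspline ℓ ((ℓ : ℝ) * 2 ^ (k + 1) * x - t)) (finite_support_bspline_sub ℓ _), Qk]
  refine tsum_congr fun s => ?_
  congr 1
  obtain ⟨n, rfl⟩ := Nat.exists_eq_succ_of_ne_zero hℓ.ne'
  rw [bspline_refinement, Finset.mul_sum]
  refine Finset.sum_congr rfl fun j _ => ?_
  rw [← mul_assoc]
  congr 2
  · rw [show (1 - ((n.succ : ℕ) : ℤ)) = -(n : ℤ) by push_cast; ring, zpow_neg, zpow_natCast,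
      inv_pow]
  · push_cast
    ring

/-- explicit formula for the coefficients `c_{k,s}(f)` in
`q_k(f) = Q_k(f) - Q_{k-1}(f) = Σ_{s∈I(k)} c_{k,s}(f) N_{k,s}`:
they are shifts of the `ℓ`-th difference `Δ_{h^{(k)}}^ℓ f` generated by `P*_even`
(`s` even) or `P*_odd` (`s` odd); for `k = 0`, `c_{0,s}(f) = T_{h^{(0)}}^{[P_Λ]}(f)(s h^{(0)})`. -/
theorem coefficient_formula_univariate (ℓ μ : ℕ) (hℓe : Even ℓ) (hℓ : 0 < ℓ)
    (hμ : ℓ/2 - 1 ≤ μ) (lam : ℤ → ℝ) (hlam : IsEvenSeq lam) (hQI : IsQuasiInterp ℓ μ lam)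
    (Pe Po : LaurentPolynomial ℝ)
    (hPe : Peven ℓ μ lam = (LaurentPolynomial.T 1 - 1) ^ ℓ * Pe)
    (hPo : Podd ℓ μ lam = (LaurentPolynomial.T 1 - 1) ^ ℓ * Po)
    (f : ℝ → ℝ) (hfc : Continuous f) (hfp : Function.Periodic f 1) :
    (∀ x : ℝ, Qk ℓ μ lam 0 f x
        = ∑ s ∈ Finset.range ℓ,
            shiftOp (PLam ℓ μ lam) (hstep ℓ 0) f ((s:ℝ) * hstep ℓ 0) * Nks ℓ 0 (s:ℤ) x) ∧
    ∀ k : ℕ, 1 ≤ k → ∀ x : ℝ,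
      Qk ℓ μ lam k f x - Qk ℓ μ lam (k-1) f x
        = ∑ s ∈ Finset.range (ℓ * 2^k),
            (if Even s then
                shiftOp Pe (hstep ℓ k) (deltaOp ℓ (hstep ℓ k) f) ((s:ℝ) * hstep ℓ k)
              else
                shiftOp Po (hstep ℓ k) (deltaOp ℓ (hstep ℓ k) f) ((s:ℝ) * hstep ℓ k))
              * Nks ℓ k (s:ℤ) x := by
  constructor
  · intro x
    rw [Qk_eq_sum_acoef ℓ μ hℓ lam 0 f hfp, pow_zero, mul_one]
    refine Finset.sum_congr rfl fun s _ => ?_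
    rw [acoef_eq_shiftOp_PLam _ _ hℓe _ hlam, Int.cast_natCast]
  · intro k hk x
    obtain ⟨k, rfl⟩ := Nat.exists_eq_add_of_le' hk
    rw [Nat.add_sub_cancel, Qk_eq_sum_acoef ℓ μ hℓ lam (k + 1) f hfp,
      Qk_eq_sum_refinedCoef ℓ μ hℓ lam k f hfp, ← Finset.sum_sub_distrib]
    refine Finset.sum_congr rfl fun s _ => ?_
    rw [← sub_mul, acoef_eq_shiftOp_PLam _ _ hℓe _ hlam]
    congr 1
    split_ifs with hs
    · rw [refinedCoef_even _ _ hℓe _ hlam _ _ (by exact_mod_cast hs), ← shiftOp_sub,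
        ← shiftOp_T_sub_one_pow, ← shiftOp_mul, mul_comm Pe, ← hPe, Peven, Int.cast_natCast]
    · rw [refinedCoef_odd _ _ hℓe _ hlam _ _ (by exact_mod_cast hs), ← shiftOp_sub,
        ← shiftOp_T_sub_one_pow, ← shiftOp_mul, mul_comm Po, ← hPo, Podd, Int.cast_natCast]
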